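/- For all d ∈ G, y ∈ G and c ∈ ℝ⟨⟨X⟩⟩, the componentwise composition product and the (componentwise) mixed composition product satisfy d ∘̄ (c ◁ y) = (d ∘̄ c) ⊲ y. -/

import Mathlib

open scoped Classical

/-!  Common setup: noncommutative formal power series ℝ⟨⟨X⟩⟩ over the
alphabet X = {x₀, x₁}.  Words are encoded as lists over `Fin 2`
(the letter `0` is x₀ and `1` is x₁); a series is a function from words
to ℝ, recording its coefficients. -/

/-- Words over the alphabet X = {x₀, x₁}. -/
abbrev Word : Type := List (Fin 2)

/-- Noncommutative formal power series ℝ⟨⟨X⟩⟩. -/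
abbrev Ser : Type := Word → ℝ

/-- The series 𝟙 (the empty word). -/
def one1 : Ser := fun w => if w = [] then 1 else 0

/-- A single word η regarded as a series. -/
def mono (η : Word) : Ser := fun w => if w = η then 1 else 0

/-- Left concatenation of a series by the letter `x_i`. -/
def lc (i : Fin 2) (c : Ser) : Ser := fun w =>
  match w with
  | [] => 0
  | j :: u => if j = i then c u else 0

/-- Auxiliary recursion computing the coefficient of a word `w` in `c ⧢ d`:
`(c ⧢ d)(𝟙) = c(𝟙) d(𝟙)` and
`(c ⧢ d)(x_i w) = ((x_i⁻¹ c) ⧢ d)(w) + (c ⧢ (x_i⁻¹ d))(w)`,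
where `x_i⁻¹` is the left shift.  This dual recursion is exactly the
bilinear extension of the inductive shuffle of words
`(x_i ξ) ⧢ (x_j η) = x_i (ξ ⧢ x_j η) + x_j (x_i ξ ⧢ η)`, `𝟙 ⧢ η = η ⧢ 𝟙 = η`. -/
def shAux : Word → Ser → Ser → ℝ
  | [], c, d => c [] * d []
  | i :: w, c, d => shAux w (fun u => c (i :: u)) d + shAux w c (fun u => d (i :: u))

/-- The shuffle product `⧢` on ℝ⟨⟨X⟩⟩. -/
def sh (c d : Ser) : Ser := fun w => shAux w c d

/-- Shuffle powers `c^{⧢ k}`. -/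
def shPow (c : Ser) : ℕ → Ser
  | 0 => one1
  | k + 1 => sh c (shPow c k)

/-- The shuffle inverse `c^{⧢ -1} = Σ_{k ≥ 0} (𝟙 - c)^{⧢ k}`.
When `c(𝟙) = 1` the sum is locally finite (for each word only finitely many
terms are nonzero) and `∑'` returns it. -/
noncomputable def shInv (c : Ser) : Ser := fun w => ∑' k : ℕ, shPow (one1 - c) k w

/-- Composition product restricted to words: `𝟙 ∘ d = 𝟙`,
`(x₀ η) ∘ d = x₀ (η ∘ d)`, `(x₁ η) ∘ d = x₀ (d ⧢ (η ∘ d))`. -/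
def wordComp : Word → Ser → Ser
  | [], _ => one1
  | i :: η, d => if i = 0 then lc 0 (wordComp η d) else lc 0 (sh d (wordComp η d))

/-- The composition product `c ∘ d = Σ_η c(η) (η ∘ d)`.  For each fixed word
only finitely many terms are nonzero, and `∑'` returns the sum. -/
noncomputable def comp (c d : Ser) : Ser := fun w => ∑' η : Word, c η * wordComp η d w

/-- Membership in the set `G`: pairs `(d₁, d₂)` with `d₁(𝟙) = 1`. -/
def inG (d : Ser × Ser) : Prop := d.1 [] = 1

/-- Mixed composition product restricted to words: `𝟙 ◁ d = 𝟙`,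
`(x₀ η) ◁ d = x₀ (η ◁ d)`,
`(x₁ η) ◁ d = x₁ (d₁ ⧢ (η ◁ d)) + x₀ (d₂ ⧢ (η ◁ d))`. -/
def wordMComp : Word → Ser × Ser → Ser
  | [], _ => one1
  | i :: η, d =>
      if i = 0 then lc 0 (wordMComp η d)
      else lc 1 (sh d.1 (wordMComp η d)) + lc 0 (sh d.2 (wordMComp η d))

/-- The mixed composition product `c ◁ d = Σ_η c(η) (η ◁ d)`. -/
noncomputable def mcomp (c : Ser) (d : Ser × Ser) : Ser :=
  fun w => ∑' η : Word, c η * wordMComp η d w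

/-- Componentwise mixed composition `c ⊲ d = (c₁ ◁ d, c₂ ◁ d)`. -/
noncomputable def tri (c d : Ser × Ser) : Ser × Ser := (mcomp c.1 d, mcomp c.2 d)

/-- Componentwise composition `d ∘̄ c = (d₁ ∘ c, d₂ ∘ c)`. -/
noncomputable def bcomp (d : Ser × Ser) (c : Ser) : Ser × Ser := (comp d.1 c, comp d.2 c)

/-- The group product `⊙` on `G`:
`(c₁, c₂) ⊙ (d₁, d₂) = (c₁ ⧢ d₁, c₂ + d₂ ⧢ c₁)`. -/
def odot (c d : Ser × Ser) : Ser × Ser := (sh c.1 d.1, c.2 + sh d.2 c.1)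

/-- The identity element `e = (𝟙, 0)`. -/
def eG : Ser × Ser := (one1, 0)

/-- The `⊙`-inverse `c^{⊙ -1} = (c₁^{⧢ -1}, -(c₁^{⧢ -1} ⧢ c₂))`. -/
noncomputable def odotInv (c : Ser × Ser) : Ser × Ser :=
  (shInv c.1, -(sh (shInv c.1) c.2))

/-- The affine feedback group product `c ⋆ d = (c ⊲ d) ⊙ d` on `G`. -/
noncomputable def star (c d : Ser × Ser) : Ser × Ser := odot (tri c d) d

/-- The `⋆`-inverse of an element of `G` (defined via choice; for an element
of the group `(G, ⋆)` it is the unique two-sided `⋆`-inverse). -/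
noncomputable def starInv (x : Ser × Ser) : Ser × Ser :=
  if h : ∃ y : Ser × Ser, inG y ∧ star x y = eG ∧ star y x = eG then h.choose else x

/-- The affine feedback product `c @ d = c ◁ ((d^{⊙ -1}) ∘̄ c)^{⋆ -1}`. -/
noncomputable def atp (c : Ser) (d : Ser × Ser) : Ser :=
  mcomp c (starInv (bcomp (odotInv d) c))

/-- Membership in ℝ[[x₀]]: series vanishing on every word containing x₁. -/
def inRx0 (c : Ser) : Prop := ∀ w : Word, (1 : Fin 2) ∈ w → c w = 0

/-- The left shift `x_i⁻¹ c` of a series. -/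
def leftShift (i : Fin 2) (c : Ser) : Ser := fun u => c (i :: u)

lemma sh_nil (a b : Ser) : sh a b [] = a [] * b [] := rfl

lemma leftShift_sh (i : Fin 2) (a b : Ser) :
    leftShift i (sh a b) = sh (leftShift i a) b + sh a (leftShift i b) := rfl

lemma sh_cons (i : Fin 2) (w : Word) (a b : Ser) :
    sh a b (i :: w) = sh (leftShift i a) b w + sh a (leftShift i b) w := rfl

lemma leftShift_add (i : Fin 2) (a b : Ser) :
    leftShift i (a + b) = leftShift i a + leftShift i b := rfl

lemma leftShift_smul (i : Fin 2) (r : ℝ) (a : Ser) :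
    leftShift i (r • a) = r • leftShift i a := rfl

lemma sh_comm (a b : Ser) : sh a b = sh b a := by
  funext w
  induction w generalizing a b with
  | nil => simp only [sh_nil, mul_comm]
  | cons i w ih => rw [sh_cons, sh_cons, ih, ih a, add_comm]

lemma sh_add_right (a b c : Ser) : sh a (b + c) = sh a b + sh a c := by
  funext w
  induction w generalizing a b c with
  | nil => simp [sh_nil, mul_add]
  | cons i w ih =>
    simp only [sh_cons, leftShift_add, ih, Pi.add_apply]
    ring

lemma sh_add_left (a b c : Ser) : sh (a + b) c = sh a c + sh b c := by
  rw [sh_comm, sh_add_right, sh_comm c a, sh_comm c b]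

lemma sh_smul_right (a : Ser) (r : ℝ) (b : Ser) : sh a (r • b) = r • sh a b := by
  funext w
  induction w generalizing a b with
  | nil => simp [sh_nil, mul_left_comm]
  | cons i w ih =>
    simp only [sh_cons, leftShift_smul, ih, Pi.smul_apply, smul_eq_mul]
    ring

lemma sh_assoc (a b c : Ser) : sh (sh a b) c = sh a (sh b c) := by
  funext w
  induction w generalizing a b c with
  | nil => simp [sh_nil, mul_assoc]
  | cons i w ih =>
    simp only [sh_cons, leftShift_sh, sh_add_left, sh_add_right, Pi.add_apply, ih]
    ring

lemma sh_left_comm (a b c : Ser) : sh a (sh b c) = sh b (sh a c) := by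
  rw [← sh_assoc, sh_comm a b, sh_assoc]

/-- The two series have the same coefficients on all words of length less than `n`. -/
def AgreeBelow (n : ℕ) (a b : Ser) : Prop := ∀ w : Word, w.length < n → a w = b w

lemma AgreeBelow.leftShift {n : ℕ} {a b : Ser} (h : AgreeBelow (n + 1) a b) (i : Fin 2) :
    AgreeBelow n (leftShift i a) (leftShift i b) :=
  fun w hw => h (i :: w) (by simpa using hw)

lemma AgreeBelow.mono {m n : ℕ} {a b : Ser} (h : AgreeBelow n a b) (hmn : m ≤ n) :
    AgreeBelow m a b :=
  fun w hw => h w (hw.trans_le hmn)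

lemma AgreeBelow.add {n : ℕ} {a a' b b' : Ser} (h : AgreeBelow n a a')
    (h' : AgreeBelow n b b') : AgreeBelow n (a + b) (a' + b') :=
  fun w hw => by simp [h w hw, h' w hw]

lemma AgreeBelow.sh {n : ℕ} {a a' b b' : Ser} (h : AgreeBelow n a a')
    (h' : AgreeBelow n b b') : AgreeBelow n (sh a b) (sh a' b') := by
  intro w
  induction w generalizing n a a' b b' with
  | nil => intro hw; rw [sh_nil, sh_nil, h [] hw, h' [] hw]
  | cons i w ih =>
    intro hw
    obtain _ | n := n
    · simp at hw
    · have hw' : w.length < n := by simpa using hw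
      rw [sh_cons, sh_cons, ih (h.leftShift i) (h'.mono n.le_succ) hw',
        ih (h.mono n.le_succ) (h'.leftShift i) hw']

lemma agreeBelow_succ {n : ℕ} {a b : Ser} (h0 : a [] = b [])
    (h : ∀ i, AgreeBelow n (leftShift i a) (leftShift i b)) : AgreeBelow (n + 1) a b := by
  rintro (_ | ⟨i, w⟩) hw
  · exact h0
  · exact h i w (by simpa using hw)

lemma ext_of_agreeBelow {a b : Ser} (h : ∀ n, AgreeBelow n a b) : a = b :=
  funext fun w => h (w.length + 1) w w.length.lt_succ_self

/-- Left concatenation by `x_i` as a linear map. -/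
def lcLin (i : Fin 2) : Ser →ₗ[ℝ] Ser where
  toFun := lc i
  map_add' a b := by
    funext w
    rcases w with _ | ⟨j, w⟩
    · simp [lc]
    · by_cases h : j = i <;> simp [lc, h]
  map_smul' r a := by
    funext w
    rcases w with _ | ⟨j, w⟩
    · simp [lc]
    · by_cases h : j = i <;> simp [lc, h]

/-- Shuffling with a fixed series as a linear map. -/
def shLin (a : Ser) : Ser →ₗ[ℝ] Ser where
  toFun := sh a
  map_add' := sh_add_right a
  map_smul' := sh_smul_right a

lemma leftShift_lc (i j : Fin 2) (a : Ser) :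
    leftShift j (lc i a) = if j = i then a else 0 := by
  funext w
  by_cases h : j = i <;> simp [leftShift, lc, h]

lemma AgreeBelow.lc {n : ℕ} {a b : Ser} (h : AgreeBelow n a b) (i : Fin 2) :
    AgreeBelow (n + 1) (lc i a) (lc i b) := by
  refine agreeBelow_succ rfl fun j => ?_
  rw [leftShift_lc, leftShift_lc]
  split_ifs
  · exact h
  · exact fun _ _ => rfl

/-- The words of length less than `n`. -/
def wordsBelow : ℕ → Finset Word
  | 0 => ∅
  | n + 1 => insert [] (Finset.univ.biUnion fun i => (wordsBelow n).image (List.cons i))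

lemma mem_wordsBelow {n : ℕ} {w : Word} : w ∈ wordsBelow n ↔ w.length < n := by
  induction n generalizing w with
  | zero => simp [wordsBelow]
  | succ n ih =>
    rcases w with _ | ⟨i, w⟩
    · simp [wordsBelow]
    · simp only [wordsBelow, Finset.mem_insert, Finset.mem_biUnion, Finset.mem_image, ih]
      simp

lemma sum_wordsBelow_succ {M : Type*} [AddCommMonoid M] (n : ℕ) (f : Word → M) :
    ∑ η ∈ wordsBelow (n + 1), f η
      = f [] + ∑ i : Fin 2, ∑ η ∈ wordsBelow n, f (i :: η) := by
  rw [wordsBelow, Finset.sum_insert (by simp), Finset.sum_biUnion]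
  · congr 1
    refine Finset.sum_congr rfl fun i _ => ?_
    exact Finset.sum_image fun a _ b _ h => (List.cons.inj h).2
  · intro i _ j _ hij
    simp only [Function.onFun, Finset.disjoint_left, Finset.mem_image]
    rintro _ ⟨u, _, rfl⟩ ⟨v, _, h⟩
    exact hij (List.cons.inj h).1.symm

section WordSum

variable {Φ : Word → Ser} {T : Fin 2 → Ser →ₗ[ℝ] Ser}

/-- The partial sum over words of length less than `n` of `Σ_η c(η) Φ(η)`. -/
noncomputable def partialSum (Φ : Word → Ser) (n : ℕ) (c : Ser) : Ser :=
  ∑ η ∈ wordsBelow n, c η • Φ η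

lemma agreeBelow_zero (hΦ : ∀ i η, Φ (i :: η) = T i (Φ η))
    (hT : ∀ i n a b, AgreeBelow n a b → AgreeBelow (n + 1) (T i a) (T i b)) (η : Word) :
    AgreeBelow η.length (Φ η) 0 := by
  induction η with
  | nil => intro w hw; simp at hw
  | cons i η ih =>
    rw [hΦ, ← map_zero (T i)]
    exact hT i _ _ _ ih

lemma tsum_agreeBelow_partialSum (hΦ : ∀ i η, Φ (i :: η) = T i (Φ η))
    (hT : ∀ i n a b, AgreeBelow n a b → AgreeBelow (n + 1) (T i a) (T i b))
    (n : ℕ) (c : Ser) :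
    AgreeBelow n (fun w => ∑' η, c η * Φ η w) (partialSum Φ n c) := by
  intro w hw
  have h : ∀ η ∉ wordsBelow n, c η * Φ η w = 0 := by
    intro η hη
    rw [mem_wordsBelow, not_lt] at hη
    rw [agreeBelow_zero hΦ hT η w (hw.trans_le hη), Pi.zero_apply, mul_zero]
  simp [partialSum, tsum_eq_sum h]

lemma tsum_add (hΦ : ∀ i η, Φ (i :: η) = T i (Φ η))
    (hT : ∀ i n a b, AgreeBelow n a b → AgreeBelow (n + 1) (T i a) (T i b)) (a b : Ser) :
    (fun w => ∑' η, (a + b) η * Φ η w)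
      = (fun w => ∑' η, a η * Φ η w) + fun w => ∑' η, b η * Φ η w := by
  refine ext_of_agreeBelow fun n w hw => ?_
  refine (tsum_agreeBelow_partialSum hΦ hT n (a + b) w hw).trans (Eq.trans ?_
    (congrArg₂ (· + ·) (tsum_agreeBelow_partialSum hΦ hT n a w hw)
      (tsum_agreeBelow_partialSum hΦ hT n b w hw)).symm)
  simp [partialSum, add_mul, Finset.sum_add_distrib]

lemma partialSum_succ (hΦ : ∀ i η, Φ (i :: η) = T i (Φ η)) (n : ℕ) (c : Ser) :
    partialSum Φ (n + 1) c
      = c [] • Φ [] + ∑ i, T i (partialSum Φ n (leftShift i c)) := by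
  simp only [partialSum, sum_wordsBelow_succ, hΦ, map_sum, map_smul, leftShift]

lemma tsum_eq_add_sum (hΦ : ∀ i η, Φ (i :: η) = T i (Φ η))
    (hT : ∀ i n a b, AgreeBelow n a b → AgreeBelow (n + 1) (T i a) (T i b)) (c : Ser) :
    (fun w => ∑' η, c η * Φ η w)
      = c [] • Φ [] + ∑ i, T i (fun w => ∑' η, leftShift i c η * Φ η w) := by
  refine ext_of_agreeBelow fun n => AgreeBelow.mono ?_ n.le_succ
  intro w hw
  rw [tsum_agreeBelow_partialSum hΦ hT (n + 1) c w hw, partialSum_succ hΦ]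
  simp only [Pi.add_apply, Finset.sum_apply]
  congr 1
  refine Finset.sum_congr rfl fun i _ => ?_
  exact (hT i n _ _ (tsum_agreeBelow_partialSum hΦ hT n _) w hw).symm

end WordSum

/-- The operators prepending a letter in the recursion for `η ∘ d`. -/
def compStep (d : Ser) (i : Fin 2) : Ser →ₗ[ℝ] Ser :=
  if i = 0 then lcLin 0 else lcLin 0 ∘ₗ shLin d

lemma wordComp_cons (d : Ser) (i : Fin 2) (η : Word) :
    wordComp (i :: η) d = compStep d i (wordComp η d) := by
  by_cases h : i = 0 <;> simp [wordComp, compStep, h, lcLin, shLin]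

lemma compStep_agreeBelow (d : Ser) (i : Fin 2) (n : ℕ) (a b : Ser) (h : AgreeBelow n a b) :
    AgreeBelow (n + 1) (compStep d i a) (compStep d i b) := by
  unfold compStep
  split_ifs
  · exact h.lc 0
  · exact (AgreeBelow.sh (fun _ _ => rfl) h).lc 0

/-- The operators prepending a letter in the recursion for `η ◁ d`. -/
def mcompStep (d : Ser × Ser) (i : Fin 2) : Ser →ₗ[ℝ] Ser :=
  if i = 0 then lcLin 0 else lcLin 1 ∘ₗ shLin d.1 + lcLin 0 ∘ₗ shLin d.2

lemma wordMComp_cons (d : Ser × Ser) (i : Fin 2) (η : Word) :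
    wordMComp (i :: η) d = mcompStep d i (wordMComp η d) := by
  by_cases h : i = 0 <;> simp [wordMComp, mcompStep, h, lcLin, shLin]

lemma mcompStep_agreeBelow (d : Ser × Ser) (i : Fin 2) (n : ℕ) (a b : Ser)
    (h : AgreeBelow n a b) : AgreeBelow (n + 1) (mcompStep d i a) (mcompStep d i b) := by
  unfold mcompStep
  split_ifs
  · exact h.lc 0
  · exact ((AgreeBelow.sh (fun _ _ => rfl) h).lc 1).add
      ((AgreeBelow.sh (fun _ _ => rfl) h).lc 0)

lemma comp_eq (c d : Ser) :
    comp c d = c [] • one1 + (lc 0 (comp (leftShift 0 c) d)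
      + lc 0 (sh d (comp (leftShift 1 c) d))) := by
  have h := tsum_eq_add_sum (Φ := fun η => wordComp η d) (wordComp_cons d)
    (compStep_agreeBelow d) c
  rw [Fin.sum_univ_two] at h
  exact h

lemma mcomp_eq (c : Ser) (d : Ser × Ser) :
    mcomp c d = c [] • one1 + (lc 0 (mcomp (leftShift 0 c) d)
      + (lc 1 (sh d.1 (mcomp (leftShift 1 c) d)) + lc 0 (sh d.2 (mcomp (leftShift 1 c) d)))) := by
  have h := tsum_eq_add_sum (Φ := fun η => wordMComp η d) (wordMComp_cons d)
    (mcompStep_agreeBelow d) c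
  rw [Fin.sum_univ_two] at h
  exact h

lemma mcomp_add (a b : Ser) (d : Ser × Ser) : mcomp (a + b) d = mcomp a d + mcomp b d :=
  tsum_add (Φ := fun η => wordMComp η d) (wordMComp_cons d) (mcompStep_agreeBelow d) a b

lemma mcomp_zero (d : Ser × Ser) : mcomp 0 d = 0 := by
  funext w
  simp [mcomp]

lemma leftShift_one1 (i : Fin 2) : leftShift i one1 = 0 := by
  funext w
  simp [leftShift, one1]

lemma comp_nil (c d : Ser) : comp c d [] = c [] := by
  rw [comp_eq]
  simp [one1, lc]

lemma mcomp_nil (c : Ser) (d : Ser × Ser) : mcomp c d [] = c [] := by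
  rw [mcomp_eq]
  simp [one1, lc]

lemma leftShift_zero_comp (c d : Ser) :
    leftShift 0 (comp c d) = comp (leftShift 0 c) d + sh d (comp (leftShift 1 c) d) := by
  rw [comp_eq]
  simp [leftShift_add, leftShift_smul, leftShift_one1, leftShift_lc]

lemma leftShift_one_comp (c d : Ser) : leftShift 1 (comp c d) = 0 := by
  rw [comp_eq]
  simp [leftShift_add, leftShift_smul, leftShift_one1, leftShift_lc]

lemma leftShift_zero_mcomp (c : Ser) (d : Ser × Ser) :
    leftShift 0 (mcomp c d)
      = mcomp (leftShift 0 c) d + sh d.2 (mcomp (leftShift 1 c) d) := by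
  rw [mcomp_eq]
  simp [leftShift_add, leftShift_smul, leftShift_one1, leftShift_lc]

lemma leftShift_one_mcomp (c : Ser) (d : Ser × Ser) :
    leftShift 1 (mcomp c d) = sh d.1 (mcomp (leftShift 1 c) d) := by
  rw [mcomp_eq]
  simp [leftShift_add, leftShift_smul, leftShift_one1, leftShift_lc]

/-- Mixed composition on the right by a fixed pair is a shuffle homomorphism. -/
lemma mcomp_sh (a b : Ser) (d : Ser × Ser) :
    mcomp (sh a b) d = sh (mcomp a d) (mcomp b d) := by
  refine ext_of_agreeBelow fun n => ?_
  induction n generalizing a b with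
  | zero => intro w hw; simp at hw
  | succ n ih =>
    have key : ∀ i, AgreeBelow n (mcomp (leftShift i (sh a b)) d)
        (sh (mcomp (leftShift i a) d) (mcomp b d)
          + sh (mcomp a d) (mcomp (leftShift i b) d)) := by
      intro i
      rw [leftShift_sh, mcomp_add]
      exact (ih _ _).add (ih _ _)
    refine agreeBelow_succ (by simp [mcomp_nil, sh_nil]) (Fin.forall_fin_two.2 ⟨?_, ?_⟩)
    · rw [leftShift_zero_mcomp, leftShift_sh _ (mcomp a d), leftShift_zero_mcomp,
        leftShift_zero_mcomp]
      convert (key 0).add (AgreeBelow.sh (a := d.2) (fun _ _ => rfl) (key 1)) using 1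
      simp only [sh_add_left, sh_add_right, sh_assoc, sh_left_comm d.2 (mcomp a d)]
      abel
    · rw [leftShift_one_mcomp, leftShift_sh _ (mcomp a d), leftShift_one_mcomp,
        leftShift_one_mcomp]
      convert AgreeBelow.sh (a := d.1) (fun _ _ => rfl) (key 1) using 1
      simp only [sh_add_right, sh_assoc, sh_left_comm d.1 (mcomp a d)]

lemma sh_zero (a : Ser) : sh a 0 = 0 := (shLin a).map_zero

/-- Composition and mixed composition are associative: `e ∘ (c ◁ y) = (e ∘ c) ◁ y`. -/
lemma comp_mcomp (e c : Ser) (y : Ser × Ser) :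
    comp e (mcomp c y) = mcomp (comp e c) y := by
  refine ext_of_agreeBelow fun n => ?_
  induction n generalizing e with
  | zero => intro w hw; simp at hw
  | succ n ih =>
    refine agreeBelow_succ (by simp [mcomp_nil, comp_nil]) (Fin.forall_fin_two.2 ⟨?_, ?_⟩)
    · rw [leftShift_zero_comp, leftShift_zero_mcomp, leftShift_zero_comp, leftShift_one_comp,
        mcomp_zero, sh_zero, add_zero, mcomp_add, mcomp_sh]
      exact (ih _).add (AgreeBelow.sh (fun _ _ => rfl) (ih _))
    · rw [leftShift_one_comp, leftShift_one_mcomp, leftShift_one_comp, mcomp_zero, sh_zero]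
      exact fun _ _ => rfl

/-- for all `d, y ∈ G` and `c ∈ ℝ⟨⟨X⟩⟩`,
`d ∘̄ (c ◁ y) = (d ∘̄ c) ⊲ y`. -/
theorem bcomp_mcomp_tri (d y : Ser × Ser) (hd : inG d) (hy : inG y) (c : Ser) :
    bcomp d (mcomp c y) = tri (bcomp d c) y :=
  Prod.ext (comp_mcomp d.1 c y) (comp_mcomp d.2 c y)
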